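/- Suppose the star-connected occupied component C(0) containing the origin is finite and nonempty. Then the outermost boundary ∂0 of C(0) is a unique finite set of cycles C_1, C_2, …, C_n in G_C with the following properties: (i) the graph ⋃_{1 ≤ i ≤ n} C_i is a connected subgraph of G_C; (ii) for i ≠ j, the cycles C_i and C_j have disjoint interiors and share at most one vertex; (iii) every square S_k ∈ C(0) is contained in the interior of some cycle C_j; (iv) every edge of every cycle C_j is a boundary edge of C(0) that is adjacent to an occupied square of C(0) lying in the interior of C_j and to a vacant square lying in the exterior of C_j. Moreover, an edge of G_C is an outermost boundary edge if and only if it is an edge of some C_j. -/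

import Mathlib

/-!
Common framework: tile ℝ² into closed unit squares indexed by `ℤ²`, with corners
forming a translate of `ℤ²` and the origin the centre of the square `S₀` (index `(0,0)`).
A cycle is identified with its edge set (a set of unordered pairs of corners);
its interior (resp. exterior) is the union of the bounded (resp. unbounded)
connected components of the complement of the closed curve it traces in the plane.
-/

/-- Corners of the grid squares, indexed by `ℤ²`. -/
abbrev GridV := ℤ × ℤ

/-- Embedding of corners into the plane: the square of index `z` is
`[z₁ - 1/2, z₁ + 1/2] × [z₂ - 1/2, z₂ + 1/2]`, so the origin is the centre of `S₀`. -/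
noncomputable def toPlane (v : GridV) : ℝ × ℝ := ((v.1 : ℝ) - 1 / 2, (v.2 : ℝ) - 1 / 2)

/-- The closed unit square of index `z`. -/
def squareSet (z : GridV) : Set (ℝ × ℝ) :=
  Set.Icc ((z.1 : ℝ) - 1 / 2, (z.2 : ℝ) - 1 / 2) ((z.1 : ℝ) + 1 / 2, (z.2 : ℝ) + 1 / 2)

/-- The four edges (unit segments) of the square of index `z`, as unordered pairs of corners. -/
def squareEdges (z : GridV) : Set (Sym2 GridV) :=
  {s(z, z + (1, 0)), s(z + (1, 0), z + (1, 1)), s(z + (1, 1), z + (0, 1)), s(z + (0, 1), z)}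

/-- Adjacency of corners in the full grid graph `G`: Euclidean distance one. -/
def GridAdj (u v : GridV) : Prop := |u.1 - v.1| + |u.2 - v.2| = 1

/-- A cycle in the full grid graph: a cyclic sequence `(v₀, …, v_{n-1}, v₀)` of
distinct corners with consecutive corners adjacent. -/
structure GridCycle where
  n : ℕ
  hn : 3 ≤ n
  f : ZMod n → GridV
  inj : Function.Injective f
  adj : ∀ i, GridAdj (f i) (f (i + 1))

/-- The edge set of a grid cycle. -/
def GridCycle.edgeSet (C : GridCycle) : Set (Sym2 GridV) :=
  {e | ∃ i : ZMod C.n, e = s(C.f i, C.f (i + 1))}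

/-- An edge set is (the edge set of) a cycle of the grid graph `G`.
We identify a cycle with its edge set. -/
def IsCycle (E : Set (Sym2 GridV)) : Prop := ∃ C : GridCycle, C.edgeSet = E

/-- A cycle of the subgraph of the grid graph with edge set `G`. -/
def IsCycleIn (G E : Set (Sym2 GridV)) : Prop := IsCycle E ∧ E ⊆ G

/-- The vertices incident to some edge of `E`. -/
def vertexSetOf (E : Set (Sym2 GridV)) : Set GridV := {v | ∃ e ∈ E, v ∈ e}

/-- The closed segment in the plane realizing an edge. -/
noncomputable def edgeSeg : Sym2 GridV → Set (ℝ × ℝ) :=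
  Sym2.lift ⟨fun a b => segment ℝ (toPlane a) (toPlane b), fun _ _ => segment_symm ℝ _ _⟩

/-- The closed curve in the plane traced by the edges of `E`. -/
noncomputable def carrierOf (E : Set (Sym2 GridV)) : Set (ℝ × ℝ) := ⋃ e ∈ E, edgeSeg e

/-- The interior of a cycle: the union of the bounded connected components of the
complement of its carrier curve. -/
noncomputable def interiorOf (E : Set (Sym2 GridV)) : Set (ℝ × ℝ) :=
  {p | p ∉ carrierOf E ∧ Bornology.IsBounded (connectedComponentIn (carrierOf E)ᶜ p)}

/-- The exterior of a cycle: the union of the unbounded connected components of the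
complement of its carrier curve. -/
noncomputable def exteriorOf (E : Set (Sym2 GridV)) : Set (ℝ × ℝ) :=
  {p | p ∉ carrierOf E ∧ ¬ Bornology.IsBounded (connectedComponentIn (carrierOf E)ᶜ p)}

/-- The set `A` is contained in the interior of the cycle `E` (points of the
curve itself being allowed, so that e.g. a square whose boundary edges lie on the
cycle counts as contained in the interior). -/
def inInterior (E : Set (Sym2 GridV)) (A : Set (ℝ × ℝ)) : Prop :=
  A ⊆ interiorOf E ∪ carrierOf E

/-- The set `A` lies in the exterior of the cycle `E` (points of the curve itself
being allowed). -/
def inExterior (E : Set (Sym2 GridV)) (A : Set (ℝ × ℝ)) : Prop :=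
  A ⊆ exteriorOf E ∪ carrierOf E

/-- Star adjacency: distinct squares sharing at least a corner. -/
def starAdj (z w : GridV) : Prop := z ≠ w ∧ |z.1 - w.1| ≤ 1 ∧ |z.2 - w.2| ≤ 1

/-- Plus adjacency: squares sharing an edge. -/
def plusAdj (z w : GridV) : Prop := |z.1 - w.1| + |z.2 - w.2| = 1

/-- The star-connected occupied component `C(0)` of the square `S₀` (of index `(0,0)`),
for the occupancy configuration `ω`; empty if `S₀` is vacant. -/
def starComp (ω : GridV → Prop) : Set GridV :=
  {z | ω z ∧ Relation.ReflTransGen (fun a b => ω a ∧ ω b ∧ starAdj a b) (0, 0) z}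

/-- The plus-connected occupied component `C⁺(0)` of the square `S₀`. -/
def plusComp (ω : GridV → Prop) : Set GridV :=
  {z | ω z ∧ Relation.ReflTransGen (fun a b => ω a ∧ ω b ∧ plusAdj a b) (0, 0) z}

/-- The edge set of the graph `G_C`: all edges of squares of `C(0)`. -/
def gcEdges (ω : GridV → Prop) : Set (Sym2 GridV) := ⋃ z ∈ starComp ω, squareEdges z

/-- The edge set of the graph `G⁺_C`: all edges of squares of `C⁺(0)`. -/
def gpcEdges (ω : GridV → Prop) : Set (Sym2 GridV) := ⋃ z ∈ plusComp ω, squareEdges z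

/-- `e` is an outermost boundary edge of the graph with edge set `G`: for every
cycle `E` in this graph, either `e` is an edge of `E` or `e` lies in the exterior of `E`. -/
def outermostBoundaryEdgeIn (G : Set (Sym2 GridV)) (e : Sym2 GridV) : Prop :=
  e ∈ G ∧ ∀ E, IsCycleIn G E → e ∈ E ∨ inExterior E (edgeSeg e)

/-- The subgraph spanned by the edge set `E` is connected: any two incident vertices
are joined by a walk using only edges of `E`. -/
def EdgeSetConnected (E : Set (Sym2 GridV)) : Prop :=
  ∀ u v, u ∈ vertexSetOf E → v ∈ vertexSetOf E →
    ∃ p : List GridV, p.head? = some u ∧ p.getLast? = some v ∧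
      List.Chain' (fun a b => s(a, b) ∈ E) p

/-- `D` is the outermost boundary cycle `D_k` of the square of index `z` of the star
component `C(0)`: (a) the square lies in the interior of `D`; (b) every edge of `D` is a
boundary edge adjacent to an occupied square of `C(0)` in the interior of `D` and to a
vacant square in the exterior of `D`; (c) every cycle of `G_C` containing the square in
its interior has all its edges on `D` or in the interior of `D`. -/
def isOutermostCycleOf (ω : GridV → Prop) (z : GridV) (D : Set (Sym2 GridV)) : Prop :=
  IsCycleIn (gcEdges ω) D ∧
  inInterior D (squareSet z) ∧
  (∀ e ∈ D,
    (∃ w ∈ starComp ω, e ∈ squareEdges w ∧ inInterior D (squareSet w)) ∧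
    (∃ w, ¬ ω w ∧ e ∈ squareEdges w ∧ inExterior D (squareSet w))) ∧
  (∀ C, IsCycleIn (gcEdges ω) C → inInterior C (squareSet z) →
    ∀ e ∈ C, e ∈ D ∨ inInterior D (edgeSeg e))

/-- The list of edges traversed by a walk given as a list of vertices. -/
def walkEdges (p : List GridV) : List (Sym2 GridV) :=
  List.zipWith (fun a b => s(a, b)) p p.tail

/-- The horizontal edge with left endpoint `z`. -/
def hEdge (z : GridV) : Sym2 GridV := s(z, z + (1, 0))

/-- The vertical edge with lower endpoint `z`. -/
def vEdge (z : GridV) : Sym2 GridV := s(z, z + (0, 1))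

theorem hEdge_injective : Function.Injective hEdge := by
  rintro ⟨a, b⟩ ⟨c, d⟩ h
  simp only [hEdge, Sym2.eq_iff, Prod.mk_add_mk, Prod.mk.injEq] at h ⊢
  omega

theorem vEdge_injective : Function.Injective vEdge := by
  rintro ⟨a, b⟩ ⟨c, d⟩ h
  simp only [vEdge, Sym2.eq_iff, Prod.mk_add_mk, Prod.mk.injEq] at h ⊢
  omega

theorem hEdge_ne_vEdge (z w : GridV) : hEdge z ≠ vEdge w := by
  obtain ⟨a, b⟩ := z
  obtain ⟨c, d⟩ := w
  simp only [hEdge, vEdge, Ne, Sym2.eq_iff, Prod.mk_add_mk, Prod.mk.injEq]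
  omega

theorem squareEdges_eq (w : GridV) :
    squareEdges w = {hEdge w, vEdge (w + (1, 0)), hEdge (w + (0, 1)), vEdge w} := by
  have h1 : s(w + (1, 0), w + (1, 1)) = vEdge (w + (1, 0)) := by
    simp [vEdge, add_assoc]
  have h2 : s(w + (1, 1), w + (0, 1)) = hEdge (w + (0, 1)) := by
    rw [Sym2.eq_swap]; simp [hEdge, add_assoc]
  have h3 : s(w + (0, 1), w) = vEdge w := Sym2.eq_swap
  rw [squareEdges, h1, h2, h3]
  rfl

theorem hEdge_mem_squareEdges {z w : GridV} :
    hEdge z ∈ squareEdges w ↔ w = z ∨ w = z - (0, 1) := by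
  simp only [squareEdges_eq, Set.mem_insert_iff, Set.mem_singleton_iff, hEdge_ne_vEdge,
    hEdge_injective.eq_iff, or_false, false_or, eq_sub_iff_add_eq, eq_comm]

theorem vEdge_mem_squareEdges {z w : GridV} :
    vEdge z ∈ squareEdges w ↔ w = z ∨ w = z - (1, 0) := by
  simp only [squareEdges_eq, Set.mem_insert_iff, Set.mem_singleton_iff,
    (hEdge_ne_vEdge _ _).symm, vEdge_injective.eq_iff, false_or, eq_sub_iff_add_eq, eq_comm]
  exact or_comm

theorem exists_hEdge_or_vEdge_of_mem {e : Sym2 GridV} {w : GridV} (h : e ∈ squareEdges w) :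
    ∃ z, e = hEdge z ∨ e = vEdge z := by
  rw [squareEdges_eq] at h
  rcases h with rfl | rfl | rfl | rfl
  exacts [⟨_, .inl rfl⟩, ⟨_, .inr rfl⟩, ⟨_, .inl rfl⟩, ⟨_, .inr rfl⟩]

theorem exists_hEdge_or_vEdge_of_adj {u v : GridV} (h : GridAdj u v) :
    ∃ z, s(u, v) = hEdge z ∧ (u = z ∧ v = z + (1, 0) ∨ v = z ∧ u = z + (1, 0)) ∨
      s(u, v) = vEdge z ∧ (u = z ∧ v = z + (0, 1) ∨ v = z ∧ u = z + (0, 1)) := by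
  obtain ⟨a, b⟩ := u
  obtain ⟨c, d⟩ := v
  have : (c = a + 1 ∧ d = b) ∨ (a = c + 1 ∧ d = b) ∨ (c = a ∧ d = b + 1) ∨
      (c = a ∧ b = d + 1) := by
    simp only [GridAdj] at h
    grind
  rcases this with ⟨rfl, rfl⟩ | ⟨rfl, rfl⟩ | ⟨rfl, rfl⟩ | ⟨rfl, rfl⟩
  · exact ⟨(a, d), .inl ⟨by simp [hEdge], .inl ⟨by simp, by simp⟩⟩⟩
  · exact ⟨(c, d), .inl ⟨by rw [Sym2.eq_swap]; simp [hEdge], .inr ⟨by simp, by simp⟩⟩⟩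
  · exact ⟨(c, b), .inr ⟨by simp [vEdge], .inl ⟨by simp, by simp⟩⟩⟩
  · exact ⟨(c, d), .inr ⟨by rw [Sym2.eq_swap]; simp [vEdge], .inr ⟨by simp, by simp⟩⟩⟩

theorem gridAdj_of_mem_squareEdges {u v w : GridV} (h : s(u, v) ∈ squareEdges w) :
    GridAdj u v := by
  obtain ⟨a, b⟩ := u
  obtain ⟨c, d⟩ := v
  obtain ⟨z, hz⟩ := exists_hEdge_or_vEdge_of_mem h
  obtain ⟨x, y⟩ := z
  simp only [hEdge, vEdge, Sym2.eq_iff, Prod.mk_add_mk, Prod.mk.injEq] at hz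
  simp only [GridAdj]
  grind

theorem plusAdj_of_mem_squareEdges {e : Sym2 GridV} {a b : GridV} (hab : a ≠ b)
    (ha : e ∈ squareEdges a) (hb : e ∈ squareEdges b) : plusAdj a b := by
  obtain ⟨⟨x, y⟩, rfl | rfl⟩ := exists_hEdge_or_vEdge_of_mem ha <;>
  simp only [hEdge_mem_squareEdges, vEdge_mem_squareEdges] at ha hb <;>
  rcases ha with rfl | rfl <;> rcases hb with rfl | rfl <;> simp_all [plusAdj]

theorem eq_or_eq_of_mem_squareEdges {e : Sym2 GridV} {a b c : GridV} (hab : a ≠ b)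
    (ha : e ∈ squareEdges a) (hb : e ∈ squareEdges b) (hc : e ∈ squareEdges c) :
    c = a ∨ c = b := by
  obtain ⟨⟨x, y⟩, rfl | rfl⟩ := exists_hEdge_or_vEdge_of_mem ha <;>
  simp only [hEdge_mem_squareEdges, vEdge_mem_squareEdges] at ha hb hc <;>
  grind

theorem plusAdj.symm {a b : GridV} (h : plusAdj a b) : plusAdj b a := by
  unfold plusAdj at *
  rwa [abs_sub_comm b.1, abs_sub_comm b.2]

theorem plusAdj.ne {a b : GridV} (h : plusAdj a b) : a ≠ b := by
  rintro rfl
  simp [plusAdj] at h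

/-- The edge shared by two plus-adjacent squares. -/
theorem plusAdj.exists_mem_squareEdges {a b : GridV} (h : plusAdj a b) :
    ∃ e, e ∈ squareEdges a ∧ e ∈ squareEdges b := by
  obtain ⟨z, ⟨-, h⟩ | ⟨-, h⟩⟩ := exists_hEdge_or_vEdge_of_adj h
  · refine ⟨vEdge (z + (1, 0)), ?_⟩
    simp only [vEdge_mem_squareEdges, add_sub_cancel_right]
    tauto
  · refine ⟨hEdge (z + (0, 1)), ?_⟩
    simp only [hEdge_mem_squareEdges, add_sub_cancel_right]
    tauto

theorem finite_squareEdges (w : GridV) : (squareEdges w).Finite := by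
  rw [squareEdges_eq]
  exact Set.toFinite _

/-- The edges separating a square of `K` from a square outside `K`. -/
def boundaryEdges (K : Set GridV) : Set (Sym2 GridV) :=
  {e | ∃ a ∈ K, ∃ b ∉ K, e ∈ squareEdges a ∧ e ∈ squareEdges b}

theorem hEdge_mem_boundaryEdges {K : Set GridV} {z : GridV} :
    hEdge z ∈ boundaryEdges K ↔ ¬ (z ∈ K ↔ z - (0, 1) ∈ K) := by
  simp only [boundaryEdges, Set.mem_ofPred_eq, hEdge_mem_squareEdges]
  grind

theorem vEdge_mem_boundaryEdges {K : Set GridV} {z : GridV} :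
    vEdge z ∈ boundaryEdges K ↔ ¬ (z ∈ K ↔ z - (1, 0) ∈ K) := by
  simp only [boundaryEdges, Set.mem_ofPred_eq, vEdge_mem_squareEdges]
  grind

/-- A boundary edge continues at each of its endpoints along another boundary edge. -/
theorem exists_boundaryEdges_extend {K : Set GridV} {u v : GridV}
    (h : s(u, v) ∈ boundaryEdges K) : ∃ w, w ≠ u ∧ s(v, w) ∈ boundaryEdges K := by
  have hadj : GridAdj u v := by
    obtain ⟨a, -, -, -, ha, -⟩ := h
    exact gridAdj_of_mem_squareEdges ha
  have e1 : s(v, v + (1, 0)) = hEdge v := rfl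
  have e2 : s(v, v - (1, 0)) = hEdge (v - (1, 0)) := by
    rw [hEdge, sub_add_cancel, Sym2.eq_swap]
  have e3 : s(v, v + (0, 1)) = vEdge v := rfl
  have e4 : s(v, v - (0, 1)) = vEdge (v - (0, 1)) := by
    rw [vEdge, sub_add_cancel, Sym2.eq_swap]
  have hcomm : v - (0, 1) - (1, 0) = v - (1, 0) - (0, 1) := sub_right_comm _ _ _
  have f1 := hEdge_mem_boundaryEdges (K := K) (z := v)
  have f2 := hEdge_mem_boundaryEdges (K := K) (z := v - (1, 0))
  have f3 := vEdge_mem_boundaryEdges (K := K) (z := v)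
  have f4 := vEdge_mem_boundaryEdges (K := K) (z := v - (0, 1))
  rw [← e1] at f1
  rw [← e2] at f2
  rw [← e3] at f3
  rw [← e4, hcomm] at f4
  have n12 : v + (1, 0) ≠ v - (1, 0) := by simp [Prod.ext_iff, GridV]; omega
  have n13 : v + (1, 0) ≠ v + (0, 1) := by simp [Prod.ext_iff, GridV]
  have n14 : v + (1, 0) ≠ v - (0, 1) := by simp [Prod.ext_iff, GridV]
  have n23 : v - (1, 0) ≠ v + (0, 1) := by simp [Prod.ext_iff, GridV]
  have n24 : v - (1, 0) ≠ v - (0, 1) := by simp [Prod.ext_iff, GridV]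
  have n34 : v + (0, 1) ≠ v - (0, 1) := by simp [Prod.ext_iff, GridV]; omega
  have hu : u = v + (1, 0) ∨ u = v - (1, 0) ∨ u = v + (0, 1) ∨ u = v - (0, 1) := by
    obtain ⟨z, ⟨-, ⟨rfl, rfl⟩ | ⟨rfl, rfl⟩⟩ | ⟨-, ⟨rfl, rfl⟩ | ⟨rfl, rfl⟩⟩⟩ :=
      exists_hEdge_or_vEdge_of_adj hadj <;> simp
  rw [Sym2.eq_swap] at h
  by_contra! hcon
  have g1 := hcon (v + (1, 0))
  have g2 := hcon (v - (1, 0))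
  have g3 := hcon (v + (0, 1))
  have g4 := hcon (v - (0, 1))
  rw [f1] at g1
  rw [f2] at g2
  rw [f3] at g3
  rw [f4] at g4
  have key : ∀ p q r s : Prop, ¬ (p ↔ q) → (r ↔ s) → (p ↔ r) → (q ↔ s) → False :=
    fun _ _ _ _ h₁ h₂ h₃ h₄ => h₁ (h₃.trans (h₂.trans h₄.symm))
  rcases hu with rfl | rfl | rfl | rfl
  · exact key _ _ _ _ (f1.1 h) (not_not.1 (g2 n12.symm)) (not_not.1 (g3 n13.symm))
      (not_not.1 (g4 n14.symm))
  · exact key _ _ _ _ (f2.1 h) (not_not.1 (g1 n12)) (not_not.1 (g3 n23.symm)).symm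
      (not_not.1 (g4 n24.symm)).symm
  · exact key _ _ _ _ (f3.1 h) (not_not.1 (g4 n34.symm)) (not_not.1 (g1 n13))
      (not_not.1 (g2 n23))
  · exact key _ _ _ _ (f4.1 h) (not_not.1 (g3 n34)) (not_not.1 (g1 n14)).symm
      (not_not.1 (g2 n24)).symm

/-- The `ZMod 2`-valued degree at the corner `v` of a `ZMod 2`-valued edge weighting. -/
def chainBoundary (c : Sym2 GridV → ZMod 2) (v : GridV) : ZMod 2 :=
  c (hEdge v) + c (hEdge (v - (1, 0))) + c (vEdge v) + c (vEdge (v - (0, 1)))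

theorem chainBoundary_add (c d : Sym2 GridV → ZMod 2) (v : GridV) :
    chainBoundary (c + d) v = chainBoundary c v + chainBoundary d v := by
  simp only [chainBoundary, Pi.add_apply]
  ring

open Classical in
theorem chainBoundary_single {u w : GridV} (h : GridAdj u w) (v : GridV) :
    chainBoundary (Pi.single s(u, w) 1) v =
      (if v = u then 1 else 0) + (if v = w then 1 else 0) := by
  obtain ⟨z, ⟨he, ⟨rfl, rfl⟩ | ⟨rfl, rfl⟩⟩ | ⟨he, ⟨rfl, rfl⟩ | ⟨rfl, rfl⟩⟩⟩ :=
    exists_hEdge_or_vEdge_of_adj h <;>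
  rw [he] <;>
  simp only [chainBoundary, Pi.single_apply, hEdge_injective.eq_iff, vEdge_injective.eq_iff,
    hEdge_ne_vEdge, (hEdge_ne_vEdge _ _).symm, sub_eq_iff_eq_add, if_false, add_zero, zero_add]
  all_goals rw [add_comm]

/-- A closed `ZMod 2`-chain vanishing to the right of the column `N` is the coboundary of a
function on the squares which vanishes to the right of the column `N`. -/
theorem exists_potential {c : Sym2 GridV → ZMod 2} {N : ℤ}
    (hh : ∀ z : GridV, N ≤ z.1 → c (hEdge z) = 0) (hv : ∀ z : GridV, N < z.1 → c (vEdge z) = 0)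
    (hc : ∀ v, chainBoundary c v = 0) :
    ∃ f : GridV → ZMod 2, (∀ z, N ≤ z.1 → f z = 0) ∧
      ∀ a b e, a ≠ b → e ∈ squareEdges a → e ∈ squareEdges b → f a + f b = c e := by
  have two : ∀ x : ZMod 2, x + x = 0 := CharTwo.add_self_eq_zero
  have horiz : ∀ y x : ℤ, x ≤ N →
      ∑ m ∈ Finset.Ioc x N, (c (vEdge (m, y)) + c (vEdge (m, y - 1))) = c (hEdge (x, y)) := by
    intro y x hx
    induction x, hx using Int.leInductionDown with
    | base => simp [hh (N, y) le_rfl]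
    | pred x hx ih =>
      have : Finset.Ioc (x - 1) N = insert x (Finset.Ioc x N) := by
        ext m; simp only [Finset.mem_Ioc, Finset.mem_insert]; omega
      rw [this, Finset.sum_insert (by simp), ih]
      have := hc (x, y)
      simp only [chainBoundary, Prod.mk_sub_mk, sub_zero] at this
      grind
  let f : GridV → ZMod 2 := fun z => ∑ m ∈ Finset.Ioc z.1 N, c (vEdge (m, z.2))
  have hf0 : ∀ z, N ≤ z.1 → f z = 0 := fun z hz => by simp [f, Finset.Ioc_eq_empty_of_le hz]
  have hfv : ∀ z, f z + f (z - (1, 0)) = c (vEdge z) := by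
    rintro ⟨x, y⟩
    by_cases hx : x ≤ N
    · have : Finset.Ioc (x - 1) N = insert x (Finset.Ioc x N) := by
        ext m; simp only [Finset.mem_Ioc, Finset.mem_insert]; omega
      simp only [f, Prod.mk_sub_mk, sub_zero]
      rw [this, Finset.sum_insert (by simp)]
      grind
    · rw [hf0 _ (by simp; omega), hf0 _ (by simp; omega), hv _ (by simpa using hx), add_zero]
  have hfh : ∀ z, f z + f (z - (0, 1)) = c (hEdge z) := by
    rintro ⟨x, y⟩
    by_cases hx : x ≤ N
    · rw [← horiz y x hx, Finset.sum_add_distrib]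
      simp only [f, Prod.mk_sub_mk, sub_zero]
    · rw [hf0 _ (by simp; omega), hf0 _ (by simp; omega), hh _ (by simp; omega), add_zero]
  refine ⟨f, hf0, fun a b e hab ha hb => ?_⟩
  obtain ⟨z, rfl | rfl⟩ := exists_hEdge_or_vEdge_of_mem ha
  · rw [hEdge_mem_squareEdges] at ha hb
    rcases ha with rfl | rfl <;> rcases hb with rfl | rfl
    · exact absurd rfl hab
    · exact hfh _
    · rw [add_comm]; exact hfh _
    · exact absurd rfl hab
  · rw [vEdge_mem_squareEdges] at ha hb
    rcases ha with rfl | rfl <;> rcases hb with rfl | rfl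
    · exact absurd rfl hab
    · exact hfv _
    · rw [add_comm]; exact hfv _
    · exact absurd rfl hab

instance (C : GridCycle) : NeZero C.n := ⟨by have := C.hn; omega⟩

/-- The edge of a cycle joining its `i`-th corner to the next one. -/
def GridCycle.edge (C : GridCycle) (i : ZMod C.n) : Sym2 GridV := s(C.f i, C.f (i + 1))

theorem GridCycle.edge_mem (C : GridCycle) (i : ZMod C.n) : C.edge i ∈ C.edgeSet := ⟨i, rfl⟩

theorem GridCycle.two_ne_zero (C : GridCycle) : (1 + 1 : ZMod C.n) ≠ 0 := by
  intro h
  have h2 : ((2 : ℕ) : ZMod C.n) = 0 := by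
    rw [← h]; push_cast; norm_num
  rw [ZMod.natCast_eq_zero_iff] at h2
  have := Nat.le_of_dvd two_pos h2
  have := C.hn
  omega

theorem GridCycle.edge_injective (C : GridCycle) : Function.Injective C.edge := by
  intro i j h
  rcases Sym2.eq_iff.1 h with ⟨h, -⟩ | ⟨h1, h2⟩
  · exact C.inj h
  · have h1 := C.inj h1
    have h2 := C.inj h2
    rw [h1, add_assoc] at h2
    exact absurd (add_eq_left.1 h2) C.two_ne_zero

theorem GridCycle.mem_vertexSetOf {C : GridCycle} {v : GridV} :
    v ∈ vertexSetOf C.edgeSet ↔ ∃ i, v = C.f i := by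
  constructor
  · rintro ⟨e, ⟨i, rfl⟩, hv⟩
    rcases Sym2.mem_iff.1 hv with h | h
    exacts [⟨_, h⟩, ⟨_, h⟩]
  · rintro ⟨i, rfl⟩
    exact ⟨_, C.edge_mem i, Sym2.mem_mk_left _ _⟩

/-- The only edges of a cycle at a corner are the two consecutive ones. -/
theorem GridCycle.eq_of_mem_edge {C : GridCycle} {i j : ZMod C.n} (h : C.f (i + 1) ∈ C.edge j) :
    j = i ∨ j = i + 1 := by
  rcases Sym2.mem_iff.1 h with h | h
  · exact .inr (C.inj h).symm
  · exact .inl (add_right_cancel (C.inj h)).symm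

/-- Every edge of a cycle is followed by another edge at each of its endpoints. -/
theorem GridCycle.exists_other_edge {C : GridCycle} {e : Sym2 GridV} {v : GridV}
    (he : e ∈ C.edgeSet) (hv : v ∈ e) : ∃ e' ∈ C.edgeSet, e' ≠ e ∧ v ∈ e' := by
  obtain ⟨i, rfl⟩ := he
  have one : (1 : ZMod C.n) ≠ 0 := fun h => C.two_ne_zero (by rw [h, add_zero])
  rcases Sym2.mem_iff.1 hv with rfl | rfl
  · refine ⟨C.edge (i - 1), C.edge_mem _, fun h => ?_, by simp [GridCycle.edge]⟩
    exact one (sub_eq_self.1 (C.edge_injective h))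
  · refine ⟨C.edge (i + 1), C.edge_mem _, fun h => ?_, by simp [GridCycle.edge]⟩
    exact one (add_eq_left.1 (C.edge_injective h))

theorem GridCycle.induction_on {C : GridCycle} {p : ZMod C.n → Prop} {a : ZMod C.n} (h0 : p a)
    (hs : ∀ i, p i → p (i + 1)) (b : ZMod C.n) : p b := by
  have : ∀ m : ℕ, p (a + m) := by
    intro m
    induction m with
    | zero => simpa using h0
    | succ m ih => simpa [add_assoc] using hs _ ih
  simpa using this (b - a).val

theorem IsCycle.eq_of_subset {E₁ E₂ : Set (Sym2 GridV)} (h₁ : IsCycle E₁) (h₂ : IsCycle E₂)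
    (h : E₁ ⊆ E₂) : E₁ = E₂ := by
  obtain ⟨C, rfl⟩ := h₁
  obtain ⟨D, rfl⟩ := h₂
  obtain ⟨a, ha : C.edge 0 = D.edge a⟩ := h (C.edge_mem 0)
  refine h.antisymm ?_
  rintro _ ⟨b, rfl⟩
  refine D.induction_on (p := fun i => D.edge i ∈ C.edgeSet) (a := a) (ha ▸ C.edge_mem 0)
    (fun i hi => ?_) b
  obtain ⟨e, he, hne, hv⟩ := GridCycle.exists_other_edge (v := D.f (i + 1)) hi
    (Sym2.mem_mk_right _ _)
  obtain ⟨j, rfl⟩ := h he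
  rcases GridCycle.eq_of_mem_edge hv with rfl | rfl
  · exact absurd rfl hne
  · exact he

open Classical in
/-- The `ZMod 2`-chain of the arc of `m` consecutive edges of `C` starting at index `a`. -/
noncomputable def GridCycle.arcChain (C : GridCycle) (a : ZMod C.n) (m : ℕ) :
    Sym2 GridV → ZMod 2 :=
  ∑ i ∈ Finset.range m, Pi.single (C.edge (a + i)) 1

theorem GridCycle.mem_of_arcChain_ne_zero {C : GridCycle} {a : ZMod C.n} {m : ℕ}
    {e : Sym2 GridV} (h : C.arcChain a m e ≠ 0) : e ∈ C.edgeSet := by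
  classical
  rw [GridCycle.arcChain, Finset.sum_apply] at h
  obtain ⟨i, -, hi⟩ := Finset.exists_ne_zero_of_sum_ne_zero h
  rw [Pi.single_apply] at hi
  by_cases he : e = C.edge (a + i)
  · exact ⟨_, he⟩
  · exact absurd (if_neg he) hi

open Classical in
theorem GridCycle.chainBoundary_arcChain (C : GridCycle) (a : ZMod C.n) (m : ℕ) (v : GridV) :
    chainBoundary (C.arcChain a m) v =
      (if v = C.f a then 1 else 0) + (if v = C.f (a + m) then 1 else 0) := by
  have two : ∀ x : ZMod 2, x + x = 0 := CharTwo.add_self_eq_zero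
  induction m with
  | zero => simp [GridCycle.arcChain, chainBoundary, two]
  | succ m ih =>
    have : C.arcChain a (m + 1) = C.arcChain a m + Pi.single (C.edge (a + m)) 1 :=
      Finset.sum_range_succ _ _
    rw [this, chainBoundary_add, ih, GridCycle.edge, chainBoundary_single (C.adj _), add_assoc,
      ← add_assoc (if v = C.f (a + m) then _ else _), two, zero_add]
    push_cast
    rw [add_assoc]

theorem GridCycle.natCast_inj {C : GridCycle} {i j : ℕ} (hi : i < C.n) (hj : j < C.n) :
    (i : ZMod C.n) = j ↔ i = j := by
  rw [ZMod.natCast_eq_natCast_iff', Nat.mod_eq_of_lt hi, Nat.mod_eq_of_lt hj]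

theorem GridCycle.arcChain_edge {C : GridCycle} {a : ZMod C.n} {m j : ℕ} (hm : m ≤ C.n)
    (hj : j < C.n) : C.arcChain a m (C.edge (a + j)) = if j < m then 1 else 0 := by
  classical
  rw [GridCycle.arcChain, Finset.sum_apply]
  simp only [Pi.single_apply, C.edge_injective.eq_iff, add_right_inj]
  rw [Finset.sum_congr rfl (g := fun i => if j = i then (1 : ZMod 2) else 0), Finset.sum_ite_eq]
  · simp
  · intro i hi
    simp only [GridCycle.natCast_inj hj ((Finset.mem_range.1 hi).trans_le hm)]

/-- A cycle carries a closed chain which is nonzero exactly on its edges. -/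
theorem GridCycle.exists_closed_chain (C : GridCycle) :
    ∃ c : Sym2 GridV → ZMod 2, (∀ e, c e ≠ 0 ↔ e ∈ C.edgeSet) ∧ ∀ v, chainBoundary c v = 0 := by
  refine ⟨C.arcChain 0 C.n, fun e => ⟨C.mem_of_arcChain_ne_zero, ?_⟩, fun v => ?_⟩
  · rintro ⟨i, rfl⟩
    have := C.arcChain_edge (a := 0) le_rfl (ZMod.val_lt i)
    rw [if_pos (ZMod.val_lt i), ZMod.natCast_zmod_val, zero_add] at this
    exact this ▸ one_ne_zero
  · rw [C.chainBoundary_arcChain, ZMod.natCast_self, add_zero, CharTwo.add_self_eq_zero]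

open Classical in
/-- Two distinct corners of a cycle are joined by an arc which is not the whole cycle. -/
theorem GridCycle.exists_arc {C : GridCycle} {v w : GridV} (hv : v ∈ vertexSetOf C.edgeSet)
    (hw : w ∈ vertexSetOf C.edgeSet) (hvw : v ≠ w) :
    ∃ c : Sym2 GridV → ZMod 2, (∀ e, c e ≠ 0 → e ∈ C.edgeSet) ∧
      (∀ x, chainBoundary c x = (if x = v then 1 else 0) + (if x = w then 1 else 0)) ∧
      (∃ e ∈ C.edgeSet, c e = 1) ∧ ∃ e ∈ C.edgeSet, c e = 0 := by
  obtain ⟨a, rfl⟩ := GridCycle.mem_vertexSetOf.1 hv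
  obtain ⟨b, rfl⟩ := GridCycle.mem_vertexSetOf.1 hw
  have hlt : (b - a).val < C.n := ZMod.val_lt _
  have hpos : 0 < (b - a).val := by
    rw [Nat.pos_iff_ne_zero, Ne, ZMod.val_eq_zero, sub_eq_zero]
    rintro rfl
    exact hvw rfl
  refine ⟨C.arcChain a (b - a).val, fun e => C.mem_of_arcChain_ne_zero, fun x => ?_,
    ⟨_, C.edge_mem (a + (0 : ℕ)), ?_⟩, ⟨_, C.edge_mem (a + ((b - a).val : ℕ)), ?_⟩⟩
  · rw [C.chainBoundary_arcChain]
    simp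
  · rw [C.arcChain_edge hlt.le (by omega), if_pos hpos]
  · rw [C.arcChain_edge hlt.le hlt, if_neg (lt_irrefl _)]

/-- A nonempty finite graph in the grid without dead ends contains a cycle. -/
theorem exists_cycle_of_no_dead_end {E : Set (Sym2 GridV)} (hfin : E.Finite)
    (hadj : ∀ u v, s(u, v) ∈ E → GridAdj u v) (hne : E.Nonempty)
    (hext : ∀ u v, s(u, v) ∈ E → ∃ w, w ≠ u ∧ s(v, w) ∈ E) :
    ∃ C : GridCycle, C.edgeSet ⊆ E := by
  have hirr : ∀ u, s(u, u) ∉ E := fun u hu => by simpa [GridAdj] using hadj u u hu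
  obtain ⟨⟨u, v⟩, huv⟩ := hne
  choose! next hnext using hext
  let step : GridV × GridV → GridV × GridV := fun p => (p.2, next p.1 p.2)
  let g : ℕ → GridV := fun k => (step^[k] (u, v)).1
  have hstep : ∀ k, step^[k + 1] (u, v) = step (step^[k] (u, v)) := fun k =>
    Function.iterate_succ_apply' _ _ _
  have hg1 : ∀ k, g (k + 1) = (step^[k] (u, v)).2 := fun k => by simp only [g, hstep]; rfl
  have hedge : ∀ k, s(g k, g (k + 1)) ∈ E := by
    intro k
    induction k with
    | zero => exact huv
    | succ k ih =>
      have := (hnext _ _ ih).2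
      rw [hg1 (k + 1), hstep, hg1 k] at *
      exact this
  have hback : ∀ k, g (k + 2) ≠ g k := by
    intro k
    have := (hnext _ _ (hedge k)).1
    rw [hg1 (k + 1), hstep]
    rwa [hg1 k] at this
  have hrange : (Set.range g).Finite := by
    have hV : (⋃ e ∈ E, {x | x ∈ e}).Finite := by
      refine hfin.biUnion fun e _ => ?_
      induction e with
      | h x y => exact (Set.toFinite {x, y}).subset fun z hz => by simpa using hz
    refine hV.subset ?_
    rintro _ ⟨k, rfl⟩
    simp only [Set.mem_iUnion]
    exact ⟨_, hedge k, Sym2.mem_mk_left _ _⟩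
  have hrep : ∃ d, 0 < d ∧ ∃ i, g i = g (i + d) := by
    have : ¬ Function.Injective g := fun h => Set.infinite_range_of_injective h hrange
    simp only [Function.Injective, not_forall] at this
    obtain ⟨i, j, hij, hne⟩ := this
    rcases Nat.lt_or_gt_of_ne hne with h | h
    · exact ⟨j - i, by omega, i, by rw [hij]; congr 1; omega⟩
    · exact ⟨i - j, by omega, j, by rw [← hij]; congr 1; omega⟩
  classical
  set d := Nat.find hrep with hd
  obtain ⟨hdpos, i, hi⟩ := Nat.find_spec hrep
  rw [← hd] at hdpos hi
  have hmin : ∀ a b, a < b → b < d → g (i + a) ≠ g (i + b) := by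
    intro a b hab hb h
    refine Nat.find_min hrep (m := b - a) (by omega) ⟨by omega, i + a, ?_⟩
    rw [h]; congr 1; omega
  have hd3 : 3 ≤ d := by
    by_contra hlt
    have : d = 1 ∨ d = 2 := by omega
    rcases this with h | h
    · rw [h] at hi
      have := hedge i
      rw [← hi] at this
      exact hirr _ this
    · rw [h] at hi
      exact hback i hi.symm
  have : NeZero d := ⟨by omega⟩
  have hsucc : ∀ x : ZMod d, g (i + (x + 1).val) = g (i + x.val + 1) := by
    intro x
    have : Fact (1 < d) := ⟨by omega⟩
    rw [ZMod.val_add, ZMod.val_one]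
    have hx := ZMod.val_lt x
    rcases Nat.lt_or_ge (x.val + 1) d with h | h
    · rw [Nat.mod_eq_of_lt h]; rfl
    · have : x.val + 1 = d := by omega
      rw [this, Nat.mod_self, add_assoc, this, ← hi]; rfl
  refine ⟨⟨d, hd3, fun x => g (i + x.val), fun x y hxy => ?_, fun x => ?_⟩, ?_⟩
  · by_contra hne
    have hne' : x.val ≠ y.val := fun h => hne (ZMod.val_injective d h)
    rcases Nat.lt_or_gt_of_ne hne' with h | h
    · exact hmin _ _ h (ZMod.val_lt y) hxy
    · exact hmin _ _ h (ZMod.val_lt x) hxy.symm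
  · simp only [hsucc]
    exact hadj _ _ (hedge _)
  · rintro _ ⟨x, rfl⟩
    simp only [hsucc]
    exact hedge _

theorem mem_squareSet {w : GridV} {p : ℝ × ℝ} :
    p ∈ squareSet w ↔ ((w.1 : ℝ) - 1 / 2 ≤ p.1 ∧ p.1 ≤ w.1 + 1 / 2) ∧
      ((w.2 : ℝ) - 1 / 2 ≤ p.2 ∧ p.2 ≤ w.2 + 1 / 2) := by
  simp only [squareSet, Set.mem_Icc, Prod.le_def]
  tauto

theorem mem_edgeSeg_hEdge {z : GridV} {p : ℝ × ℝ} :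
    p ∈ edgeSeg (hEdge z) ↔ ((z.1 : ℝ) - 1 / 2 ≤ p.1 ∧ p.1 ≤ z.1 + 1 / 2) ∧
      p.2 = z.2 - 1 / 2 := by
  have h : edgeSeg (hEdge z) =
      (fun x => (x, (z.2 : ℝ) - 1 / 2)) '' segment ℝ ((z.1 : ℝ) - 1 / 2) (z.1 + 1 / 2) := by
    rw [Prod.image_mk_segment_left]
    simp only [edgeSeg, hEdge, Sym2.lift_mk, toPlane]
    congr 2 <;> (push_cast [Prod.fst_add, Prod.snd_add]; ring)
  rw [h, segment_eq_Icc (by linarith)]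
  obtain ⟨x, y⟩ := p
  simp only [Set.mem_image, Set.mem_Icc, Prod.mk.injEq]
  constructor
  · rintro ⟨_, hx, rfl, rfl⟩
    exact ⟨hx, rfl⟩
  · rintro ⟨hx, rfl⟩
    exact ⟨_, hx, rfl, rfl⟩

theorem mem_edgeSeg_vEdge {z : GridV} {p : ℝ × ℝ} :
    p ∈ edgeSeg (vEdge z) ↔ p.1 = z.1 - 1 / 2 ∧
      ((z.2 : ℝ) - 1 / 2 ≤ p.2 ∧ p.2 ≤ z.2 + 1 / 2) := by
  have h : edgeSeg (vEdge z) =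
      (fun y => ((z.1 : ℝ) - 1 / 2, y)) '' segment ℝ ((z.2 : ℝ) - 1 / 2) (z.2 + 1 / 2) := by
    rw [Prod.image_mk_segment_right]
    simp only [edgeSeg, vEdge, Sym2.lift_mk, toPlane]
    congr 2 <;> (push_cast [Prod.fst_add, Prod.snd_add]; ring)
  rw [h, segment_eq_Icc (by linarith)]
  obtain ⟨x, y⟩ := p
  simp only [Set.mem_image, Set.mem_Icc, Prod.mk.injEq]
  constructor
  · rintro ⟨_, hx, rfl, rfl⟩
    exact ⟨rfl, hx⟩
  · rintro ⟨rfl, hx⟩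
    exact ⟨_, hx, rfl, rfl⟩

theorem edgeSeg_subset_squareSet {e : Sym2 GridV} {w : GridV} (h : e ∈ squareEdges w) :
    edgeSeg e ⊆ squareSet w := by
  intro p hp
  obtain ⟨z, rfl | rfl⟩ := exists_hEdge_or_vEdge_of_mem h
  · rw [mem_edgeSeg_hEdge] at hp
    rw [mem_squareSet]
    rcases hEdge_mem_squareEdges.1 h with rfl | rfl
    · exact ⟨hp.1, by linarith, by linarith⟩
    · simp only [Prod.fst_sub, Prod.snd_sub]
      push_cast
      exact ⟨by simpa using hp.1, by linarith, by linarith⟩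
  · rw [mem_edgeSeg_vEdge] at hp
    rw [mem_squareSet]
    rcases vEdge_mem_squareEdges.1 h with rfl | rfl
    · exact ⟨⟨by linarith, by linarith⟩, hp.2⟩
    · simp only [Prod.fst_sub, Prod.snd_sub]
      push_cast
      exact ⟨⟨by linarith, by linarith⟩, by simpa using hp.2⟩

/-- Every grid edge has a point lying on no other grid edge. -/
theorem exists_mem_edgeSeg_unique {e : Sym2 GridV} {w : GridV} (h : e ∈ squareEdges w) :
    ∃ m ∈ edgeSeg e, ∀ e' w', e' ∈ squareEdges w' → m ∈ edgeSeg e' → e' = e := by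
  have near : ∀ t z : ℤ, (t : ℝ) - 1 / 2 ≤ z → (z : ℝ) ≤ t + 1 / 2 → t = z := by
    intro t z h1 h2
    have h1 : (t : ℝ) < z + 1 := by linarith
    have h2 : (z : ℝ) < t + 1 := by linarith
    norm_cast at h1 h2
    omega
  have half : ∀ t z : ℤ, (z : ℝ) ≠ t - 1 / 2 := by
    intro t z h
    have : (2 * z : ℝ) = 2 * t - 1 := by linarith
    norm_cast at this
    omega
  obtain ⟨⟨x, y⟩, rfl | rfl⟩ := exists_hEdge_or_vEdge_of_mem h
  · refine ⟨((x : ℝ), (y : ℝ) - 1 / 2), ?_, fun e' w' h' hm => ?_⟩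
    · rw [mem_edgeSeg_hEdge]
      exact ⟨⟨by linarith, by linarith⟩, rfl⟩
    · obtain ⟨⟨a, b⟩, rfl | rfl⟩ := exists_hEdge_or_vEdge_of_mem h'
      · rw [mem_edgeSeg_hEdge] at hm
        have h1 : a = x := near _ _ hm.1.1 hm.1.2
        have h2 : (y : ℝ) = b := by linarith [hm.2]
        norm_cast at h2
        rw [h1, h2]
      · rw [mem_edgeSeg_vEdge] at hm
        exact absurd hm.1 (half _ _)
  · refine ⟨((x : ℝ) - 1 / 2, (y : ℝ)), ?_, fun e' w' h' hm => ?_⟩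
    · rw [mem_edgeSeg_vEdge]
      exact ⟨rfl, by linarith, by linarith⟩
    · obtain ⟨⟨a, b⟩, rfl | rfl⟩ := exists_hEdge_or_vEdge_of_mem h'
      · rw [mem_edgeSeg_hEdge] at hm
        exact absurd hm.2 (half _ _)
      · rw [mem_edgeSeg_vEdge] at hm
        have h1 : b = y := near _ _ hm.2.1 hm.2.2
        have h2 : (x : ℝ) = a := by linarith [hm.1]
        norm_cast at h2
        rw [h1, h2]

theorem mem_carrierOf {E : Set (Sym2 GridV)} {p : ℝ × ℝ} :
    p ∈ carrierOf E ↔ ∃ e ∈ E, p ∈ edgeSeg e := by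
  simp [carrierOf]

/-- The edges of `E` are edges of grid squares. -/
def IsGridGraph (E : Set (Sym2 GridV)) : Prop := ∀ e ∈ E, ∃ w, e ∈ squareEdges w

/-- Removing the edges of a grid graph does not disconnect a grid square. -/
theorem isPreconnected_squareSet_diff {E : Set (Sym2 GridV)} (hE : IsGridGraph E) (w : GridV) :
    IsPreconnected (squareSet w \ carrierOf E) := by
  have hprod : squareSet w = Set.Icc ((w.1 : ℝ) - 1 / 2) (w.1 + 1 / 2) ×ˢ
      Set.Icc ((w.2 : ℝ) - 1 / 2) (w.2 + 1 / 2) := by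
    rw [squareSet, Set.Icc_prod_eq]
  have hpre : IsPreconnected (Set.Ioo ((w.1 : ℝ) - 1 / 2) (w.1 + 1 / 2) ×ˢ
      Set.Ioo ((w.2 : ℝ) - 1 / 2) (w.2 + 1 / 2)) := isPreconnected_Ioo.prod isPreconnected_Ioo
  refine hpre.subset_closure ?_ ?_
  · rintro p ⟨hp1, hp2⟩
    refine ⟨hprod ▸ ⟨Set.Ioo_subset_Icc_self hp1, Set.Ioo_subset_Icc_self hp2⟩, fun hp => ?_⟩
    have off : ∀ {x : ℝ} {t z : ℤ}, x ∈ Set.Ioo ((z : ℝ) - 1 / 2) (z + 1 / 2) →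
        x ≠ t - 1 / 2 := by
      rintro _ t z ⟨h1, h2⟩ rfl
      have h1 : (z : ℝ) < t := by linarith
      have h2 : (t : ℝ) < z + 1 := by linarith
      norm_cast at h1 h2
      omega
    obtain ⟨e, he, hpe⟩ := mem_carrierOf.1 hp
    obtain ⟨w', hw'⟩ := hE e he
    obtain ⟨z, rfl | rfl⟩ := exists_hEdge_or_vEdge_of_mem hw'
    · exact off hp2 (mem_edgeSeg_hEdge.1 hpe).2
    · exact off hp1 (mem_edgeSeg_vEdge.1 hpe).1
  · rw [closure_prod_eq, closure_Ioo (by linarith), closure_Ioo (by linarith), ← hprod]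
    exact Set.sdiff_subset

theorem exists_mem_squareSet (p : ℝ × ℝ) : ∃ w, p ∈ squareSet w := by
  refine ⟨(⌊p.1 + 1 / 2⌋, ⌊p.2 + 1 / 2⌋), mem_squareSet.2 ?_⟩
  have h1 := Int.floor_le (p.1 + 1 / 2)
  have h2 := Int.lt_floor_add_one (p.1 + 1 / 2)
  have h3 := Int.floor_le (p.2 + 1 / 2)
  have h4 := Int.lt_floor_add_one (p.2 + 1 / 2)
  exact ⟨⟨by linarith, by linarith⟩, by linarith, by linarith⟩

theorem inExterior_iff {E : Set (Sym2 GridV)} {A : Set (ℝ × ℝ)} :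
    inExterior E A ↔ A \ carrierOf E ⊆ exteriorOf E := by
  rw [inExterior, Set.sdiff_subset_iff, Set.union_comm]

theorem inInterior_iff {E : Set (Sym2 GridV)} {A : Set (ℝ × ℝ)} :
    inInterior E A ↔ A \ carrierOf E ⊆ interiorOf E := by
  rw [inInterior, Set.sdiff_subset_iff, Set.union_comm]

theorem mem_exteriorOf_of_isPreconnected {E : Set (Sym2 GridV)} {S : Set (ℝ × ℝ)}
    (hS : IsPreconnected S) (hSE : S ⊆ (carrierOf E)ᶜ) {p q : ℝ × ℝ} (hp : p ∈ S) (hq : q ∈ S)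
    (hqE : q ∈ exteriorOf E) : p ∈ exteriorOf E := by
  refine ⟨hSE hp, ?_⟩
  have : q ∈ connectedComponentIn (carrierOf E)ᶜ p := hS.subset_connectedComponentIn hp hSE hq
  rw [connectedComponentIn_eq this]
  exact hqE.2

/-- Being exterior propagates through a shared edge which is not an edge of the graph. -/
theorem inExterior_squareSet_of_shared_edge {E : Set (Sym2 GridV)} (hE : IsGridGraph E)
    {a b : GridV} {e : Sym2 GridV} (ha : e ∈ squareEdges a) (hb : e ∈ squareEdges b) (he : e ∉ E)
    (h : inExterior E (squareSet a)) : inExterior E (squareSet b) := by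
  rw [inExterior_iff] at h ⊢
  obtain ⟨m, hm, huniq⟩ := exists_mem_edgeSeg_unique ha
  have hmE : m ∉ carrierOf E := by
    intro hmem
    obtain ⟨e', he', hme'⟩ := mem_carrierOf.1 hmem
    obtain ⟨w', hw'⟩ := hE e' he'
    exact he (huniq e' w' hw' hme' ▸ he')
  intro p hp
  exact mem_exteriorOf_of_isPreconnected (isPreconnected_squareSet_diff hE b) (fun _ h => h.2) hp
    ⟨edgeSeg_subset_squareSet hb hm, hmE⟩ (h ⟨edgeSeg_subset_squareSet ha hm, hmE⟩)

/-- Squares to the right of a graph are in its exterior. -/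
theorem inExterior_squareSet_of_le {E : Set (Sym2 GridV)} (hE : IsGridGraph E) {N : ℤ}
    (hN : carrierOf E ⊆ {p | p.1 ≤ (N : ℝ) - 1 / 2}) {w : GridV} (hw : N ≤ w.1) :
    inExterior E (squareSet w) := by
  rw [inExterior_iff]
  have hNw : (N : ℝ) ≤ w.1 := by exact_mod_cast hw
  set H : Set (ℝ × ℝ) := Set.Ioi ((N : ℝ) - 1 / 2) ×ˢ Set.univ with hH
  have hHpre : IsPreconnected H := isPreconnected_Ioi.prod isPreconnected_univ
  have hHE : H ⊆ (carrierOf E)ᶜ := fun p hp hpE =>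
    not_le.2 (Set.mem_Ioi.1 hp.1) (hN hpE)
  have hc : ((w.1 : ℝ), (w.2 : ℝ)) ∈ H := ⟨by simp only [Set.mem_Ioi]; linarith, trivial⟩
  have hcE : ((w.1 : ℝ), (w.2 : ℝ)) ∈ exteriorOf E := by
    refine ⟨hHE hc, fun hb => ?_⟩
    have hb' := (hb.subset (hHpre.subset_connectedComponentIn hc hHE)).image_fst
    rw [hH, Set.fst_image_prod _ Set.univ_nonempty] at hb'
    exact not_bddAbove_Ioi _ hb'.bddAbove
  have hcs : ((w.1 : ℝ), (w.2 : ℝ)) ∈ squareSet w :=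
    mem_squareSet.2 ⟨⟨by linarith, by linarith⟩, by linarith, by linarith⟩
  intro p hp
  exact mem_exteriorOf_of_isPreconnected (isPreconnected_squareSet_diff hE w) (fun _ h => h.2) hp
    ⟨hcs, hHE hc⟩ hcE

theorem exists_edgeSeg_of_mem_squareSet {a b : GridV} (h : plusAdj a b) {p : ℝ × ℝ}
    (ha : p ∈ squareSet a) (hb : p ∈ squareSet b) :
    ∃ e, e ∈ squareEdges a ∧ e ∈ squareEdges b ∧ p ∈ edgeSeg e := by
  rw [mem_squareSet] at ha hb
  obtain ⟨z, ⟨-, h⟩ | ⟨-, h⟩⟩ := exists_hEdge_or_vEdge_of_adj h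
  · refine ⟨vEdge (z + (1, 0)), ?_, ?_, ?_⟩
    · simp only [vEdge_mem_squareEdges, add_sub_cancel_right]; tauto
    · simp only [vEdge_mem_squareEdges, add_sub_cancel_right]; tauto
    · rw [mem_edgeSeg_vEdge]
      rcases h with ⟨rfl, rfl⟩ | ⟨rfl, rfl⟩ <;>
      · simp only [Prod.fst_add, Prod.snd_add, add_zero] at ha hb ⊢
        push_cast at ha hb ⊢
        exact ⟨by linarith [ha.1.1, ha.1.2, hb.1.1, hb.1.2], ha.2⟩
  · refine ⟨hEdge (z + (0, 1)), ?_, ?_, ?_⟩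
    · simp only [hEdge_mem_squareEdges, add_sub_cancel_right]; tauto
    · simp only [hEdge_mem_squareEdges, add_sub_cancel_right]; tauto
    · rw [mem_edgeSeg_hEdge]
      rcases h with ⟨rfl, rfl⟩ | ⟨rfl, rfl⟩ <;>
      · simp only [Prod.fst_add, Prod.snd_add, add_zero] at ha hb ⊢
        push_cast at ha hb ⊢
        exact ⟨ha.1, by linarith [ha.2.1, ha.2.2, hb.2.1, hb.2.2]⟩

/-- A point common to a square of `K` and a square outside `K` is on the boundary of `K`. -/
theorem mem_carrierOf_boundaryEdges {K : Set GridV} {a b : GridV} (haK : a ∈ K) (hbK : b ∉ K)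
    {p : ℝ × ℝ} (ha : p ∈ squareSet a) (hb : p ∈ squareSet b) :
    p ∈ carrierOf (boundaryEdges K) := by
  have key : ∀ {a b : GridV}, a ∈ K → b ∉ K → p ∈ squareSet a → p ∈ squareSet b →
      plusAdj a b → p ∈ carrierOf (boundaryEdges K) := by
    intro a b haK hbK ha hb h
    obtain ⟨e, hea, heb, hp⟩ := exists_edgeSeg_of_mem_squareSet h ha hb
    exact mem_carrierOf.2 ⟨e, ⟨a, haK, b, hbK, hea, heb⟩, hp⟩
  obtain ⟨ha1, ha2⟩ := mem_squareSet.1 ha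
  obtain ⟨hb1, hb2⟩ := mem_squareSet.1 hb
  have hc : p ∈ squareSet (a.1, b.2) := mem_squareSet.2 ⟨ha1, hb2⟩
  have close : ∀ {s t : ℤ} {x : ℝ}, (s : ℝ) - 1 / 2 ≤ x → x ≤ (t : ℝ) + 1 / 2 → s ≤ t + 1 := by
    intro s t x h1 h2
    have : (s : ℝ) ≤ t + 1 := by linarith
    exact_mod_cast this
  have h1 := close ha1.1 hb1.2
  have h2 := close hb1.1 ha1.2
  have h3 := close ha2.1 hb2.2
  have h4 := close hb2.1 ha2.2
  by_cases hcK : ((a.1, b.2) : GridV) ∈ K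
  · refine key hcK hbK hc hb ?_
    have : a.1 ≠ b.1 := fun h => hbK (by rwa [h] at hcK)
    simp only [plusAdj, sub_self, abs_zero, add_zero]
    grind
  · refine key haK hcK ha hc ?_
    have : a.2 ≠ b.2 := fun h => hcK (by rwa [← h])
    simp only [plusAdj, sub_self, abs_zero, zero_add]
    grind

theorem isClosed_iUnion_squareSet (K : Set GridV) : IsClosed (⋃ w : K, squareSet w) := by
  refine LocallyFinite.isClosed_iUnion (fun p => ?_) fun w => isClosed_Icc
  refine ⟨Set.Icc (p.1 - 1) (p.1 + 1) ×ˢ Set.Icc (p.2 - 1) (p.2 + 1),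
    prod_mem_nhds (Icc_mem_nhds (by linarith) (by linarith))
      (Icc_mem_nhds (by linarith) (by linarith)), ?_⟩
  have hfin : (Set.Icc ((⌊p.1⌋ - 3, ⌊p.2⌋ - 3) : GridV) (⌈p.1⌉ + 3, ⌈p.2⌉ + 3)).Finite :=
    Set.finite_Icc _ _
  refine (hfin.preimage Subtype.val_injective.injOn).subset ?_
  rintro ⟨w, hw⟩ ⟨q, hq, ⟨hq1, hq2⟩, hq3, hq4⟩
  rw [mem_squareSet] at hq
  have := Int.floor_le p.1
  have := Int.le_ceil p.1
  have := Int.floor_le p.2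
  have := Int.le_ceil p.2
  simp only [Set.mem_preimage, Set.mem_Icc, Prod.le_def]
  dsimp only at hq
  refine ⟨⟨?_, ?_⟩, ?_, ?_⟩ <;>
  · rify
    linarith [hq.1.1, hq.1.2, hq.2.1, hq.2.2]

/-- The squares of a finite set `K` lie in the interior of the boundary of `K`. -/
theorem inInterior_squareSet {K : Set GridV} (hK : K.Finite) {a : GridV} (ha : a ∈ K) :
    inInterior (boundaryEdges K) (squareSet a) := by
  rw [inInterior_iff]
  rintro p ⟨hpa, hp⟩
  refine ⟨hp, ?_⟩
  have hbdd : Bornology.IsBounded (⋃ w ∈ K, squareSet w) :=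
    (Bornology.isBounded_biUnion hK).2 fun w _ => Metric.isBounded_Icc _ _
  refine hbdd.subset ?_
  have hsub := connectedComponentIn_subset (carrierOf (boundaryEdges K))ᶜ p
  have hpre : IsPreconnected (connectedComponentIn (carrierOf (boundaryEdges K))ᶜ p) :=
    isPreconnected_connectedComponentIn
  have hself := mem_connectedComponentIn (F := (carrierOf (boundaryEdges K))ᶜ) hp
  have hcover : connectedComponentIn (carrierOf (boundaryEdges K))ᶜ p ⊆
      (⋃ w : K, squareSet w) ∪ ⋃ w : (Kᶜ : Set GridV), squareSet w := by
    intro q _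
    obtain ⟨w, hw⟩ := exists_mem_squareSet q
    by_cases hwK : w ∈ K
    · exact .inl (Set.mem_iUnion.2 ⟨⟨w, hwK⟩, hw⟩)
    · exact .inr (Set.mem_iUnion.2 ⟨⟨w, hwK⟩, hw⟩)
  have hdisj : connectedComponentIn (carrierOf (boundaryEdges K))ᶜ p ∩
      ((⋃ w : K, squareSet w) ∩ ⋃ w : (Kᶜ : Set GridV), squareSet w) = ∅ := by
    refine Set.eq_empty_of_forall_notMem ?_
    rintro q ⟨hq, hqA, hqB⟩
    obtain ⟨⟨c, hc⟩, hqc⟩ := Set.mem_iUnion.1 hqA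
    obtain ⟨⟨b, hb⟩, hqb⟩ := Set.mem_iUnion.1 hqB
    exact hsub hq (mem_carrierOf_boundaryEdges hc hb hqc hqb)
  rcases isPreconnected_iff_subset_of_disjoint_closed.1 hpre _ _ (isClosed_iUnion_squareSet K)
    (isClosed_iUnion_squareSet Kᶜ) hcover hdisj with h | h
  · rwa [← Set.biUnion_eq_iUnion K (fun w _ => squareSet w)] at h
  · obtain ⟨⟨b, hb⟩, hpb⟩ := Set.mem_iUnion.1 (h hself)
    exact absurd (mem_carrierOf_boundaryEdges ha hb hpa hpb) hp

/-- The squares from which the half-plane to the right of column `N` can be reached through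
edge-sharing squares outside `S`. -/
inductive IsOuter (S : Set GridV) (N : ℤ) : GridV → Prop
  | base {w : GridV} (h : N ≤ w.1) : IsOuter S N w
  | step {w w' : GridV} (hadj : plusAdj w w') (hw : w ∉ S) (h : IsOuter S N w') : IsOuter S N w

/-- The edge-connected component of the square `z` among the squares which are not outer. -/
def cell (S : Set GridV) (N : ℤ) (z : GridV) : Set GridV :=
  {w | Relation.ReflTransGen
    (fun a b => plusAdj a b ∧ ¬ IsOuter S N a ∧ ¬ IsOuter S N b) z w}

/-- The edges separating a square of `S` from an outer square. -/
def outerEdges (S : Set GridV) (N : ℤ) : Set (Sym2 GridV) :=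
  {e | ∃ a ∈ S, ∃ b, IsOuter S N b ∧ e ∈ squareEdges a ∧ e ∈ squareEdges b}

/-- The set `S` is contained in the open box of half-width `N`. -/
def InBox (S : Set GridV) (N : ℤ) : Prop := ∀ z ∈ S, |z.1| < N ∧ |z.2| < N

theorem exists_inBox {S : Set GridV} (hS : S.Finite) : ∃ N, InBox S N := by
  obtain ⟨M, hM⟩ := (hS.image fun z => max |z.1| |z.2|).bddAbove
  refine ⟨M + 1, fun z hz => ?_⟩
  have := max_le_iff.1 (hM ⟨z, hz, rfl⟩)
  omega

section

variable {S : Set GridV} {N : ℤ}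

theorem IsOuter.notMem (hS : InBox S N) {w : GridV} (h : IsOuter S N w) : w ∉ S := by
  cases h with
  | base h => exact fun hw => absurd (lt_of_abs_lt (hS w hw).1) (not_lt.2 h)
  | step _ hw _ => exact hw

theorem finite_not_isOuter (hS : InBox S N) : {w | ¬ IsOuter S N w}.Finite := by
  have hrow : ∀ (n : ℕ) (w : GridV), N - w.1 ≤ n → N ≤ |w.2| → IsOuter S N w := by
    intro n
    induction n with
    | zero => exact fun w h _ => .base (by simpa using h)
    | succ n ih =>
      intro w hn hw
      refine .step (w' := w + (1, 0)) (by simp [plusAdj]) (fun hwS => ?_) (ih _ ?_ (by simpa))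
      · exact absurd (hS w hwS).2 (not_lt.2 hw)
      · simp only [Prod.fst_add]; push_cast at hn; omega
  have hrow' : ∀ w : GridV, N ≤ |w.2| → IsOuter S N w := fun w =>
    hrow (N - w.1).toNat w (Int.self_le_toNat _)
  have hcol : ∀ (n : ℕ) (w : GridV), N - w.2 ≤ n → N ≤ |w.1| → IsOuter S N w := by
    intro n
    induction n with
    | zero => exact fun w h _ => hrow' w (le_abs.2 (.inl (by simpa using h)))
    | succ n ih =>
      intro w hn hw
      refine .step (w' := w + (0, 1)) (by simp [plusAdj]) (fun hwS => ?_) (ih _ ?_ (by simpa))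
      · exact absurd (hS w hwS).1 (not_lt.2 hw)
      · simp only [Prod.snd_add]; push_cast at hn; omega
  have hcol' : ∀ w : GridV, N ≤ |w.1| → IsOuter S N w := fun w =>
    hcol (N - w.2).toNat w (Int.self_le_toNat _)
  refine (Set.finite_Icc ((-N, -N) : GridV) (N, N)).subset fun w hw => ?_
  have h1 := abs_lt.1 (not_le.1 fun h => hw (hcol' w h))
  have h2 := abs_lt.1 (not_le.1 fun h => hw (hrow' w h))
  exact ⟨⟨h1.1.le, h2.1.le⟩, h1.2.le, h2.2.le⟩

theorem mem_cell_self (z : GridV) : z ∈ cell S N z := Relation.ReflTransGen.refl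

theorem not_isOuter_of_mem_cell {z w : GridV} (hz : ¬ IsOuter S N z) (hw : w ∈ cell S N z) :
    ¬ IsOuter S N w := by
  rcases Relation.ReflTransGen.cases_tail hw with rfl | ⟨_, _, h⟩
  exacts [hz, h.2.2]

theorem mem_cell_of_plusAdj {z a b : GridV} (hz : ¬ IsOuter S N z) (ha : a ∈ cell S N z)
    (hab : plusAdj a b) (hb : ¬ IsOuter S N b) : b ∈ cell S N z :=
  Relation.ReflTransGen.tail ha ⟨hab, not_isOuter_of_mem_cell hz ha, hb⟩

theorem cell_eq_of_mem {z w : GridV} (hw : w ∈ cell S N z) : cell S N w = cell S N z := by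
  have hw' : z ∈ cell S N w :=
    Relation.ReflTransGen.mono (fun a b h => ⟨h.1.symm, h.2.2, h.2.1⟩) _ _
      (Relation.ReflTransGen.swap _ _ hw)
  ext x
  exact ⟨fun h => Relation.ReflTransGen.trans hw h, fun h => Relation.ReflTransGen.trans hw' h⟩

theorem finite_cell (hS : InBox S N) {z : GridV} (hz : ¬ IsOuter S N z) :
    (cell S N z).Finite :=
  (finite_not_isOuter hS).subset fun _ => not_isOuter_of_mem_cell hz

theorem exists_of_mem_boundaryEdges_cell {z : GridV} (hz : ¬ IsOuter S N z)
    {e : Sym2 GridV} (he : e ∈ boundaryEdges (cell S N z)) :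
    ∃ a ∈ S, a ∈ cell S N z ∧ ∃ b, IsOuter S N b ∧ e ∈ squareEdges a ∧ e ∈ squareEdges b := by
  obtain ⟨a, ha, b, hb, hea, heb⟩ := he
  have hab : plusAdj a b := plusAdj_of_mem_squareEdges (fun h => hb (h ▸ ha)) hea heb
  have hbo : IsOuter S N b := by_contra fun h => hb (mem_cell_of_plusAdj hz ha hab h)
  have haS : a ∈ S := by_contra fun h => not_isOuter_of_mem_cell hz ha (.step hab h hbo)
  exact ⟨a, haS, ha, b, hbo, hea, heb⟩

theorem mem_boundaryEdges_cell {z a b : GridV} (hz : ¬ IsOuter S N z) (ha : a ∈ cell S N z)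
    (hb : IsOuter S N b) {e : Sym2 GridV} (hea : e ∈ squareEdges a) (heb : e ∈ squareEdges b) :
    e ∈ boundaryEdges (cell S N z) :=
  ⟨a, ha, b, fun h => not_isOuter_of_mem_cell hz h hb, hea, heb⟩

theorem boundaryEdges_cell_subset {z : GridV} (hz : ¬ IsOuter S N z) :
    boundaryEdges (cell S N z) ⊆ outerEdges S N := fun _ he =>
  let ⟨a, ha, _, h⟩ := exists_of_mem_boundaryEdges_cell hz he
  ⟨a, ha, h⟩

theorem cell_eq_of_mem_boundaryEdges {z z' : GridV} (hz : ¬ IsOuter S N z)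
    (hz' : ¬ IsOuter S N z') {e : Sym2 GridV} (he : e ∈ boundaryEdges (cell S N z))
    (he' : e ∈ boundaryEdges (cell S N z')) : cell S N z = cell S N z' := by
  obtain ⟨a, -, ha, b, hb, hea, heb⟩ := exists_of_mem_boundaryEdges_cell hz he
  obtain ⟨a', -, ha', -, -, hea', -⟩ := exists_of_mem_boundaryEdges_cell hz' he'
  have hab : a ≠ b := fun h => not_isOuter_of_mem_cell hz ha (h ▸ hb)
  rcases eq_or_eq_of_mem_squareEdges hab hea heb hea' with rfl | rfl
  · rw [← cell_eq_of_mem ha, ← cell_eq_of_mem ha']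
  · exact absurd hb (not_isOuter_of_mem_cell hz' ha')

theorem outerEdges_subset : outerEdges S N ⊆ ⋃ z ∈ S, squareEdges z := by
  rintro e ⟨a, ha, -, -, hea, -⟩
  exact Set.mem_biUnion ha hea

theorem isGridGraph_of_subset {E : Set (Sym2 GridV)} (hE : E ⊆ ⋃ z ∈ S, squareEdges z) :
    IsGridGraph E := by
  intro e he
  obtain ⟨z, -, hz⟩ := Set.mem_iUnion₂.1 (hE he)
  exact ⟨z, hz⟩

theorem inExterior_of_isRight (hS : InBox S N) {E : Set (Sym2 GridV)}
    (hE : E ⊆ ⋃ z ∈ S, squareEdges z) {w : GridV} (hw : N ≤ w.1) :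
    inExterior E (squareSet w) := by
  refine inExterior_squareSet_of_le (isGridGraph_of_subset hE) (fun p hp => ?_) hw
  obtain ⟨e, he, hpe⟩ := mem_carrierOf.1 hp
  obtain ⟨z, hz, hez⟩ := Set.mem_iUnion₂.1 (hE he)
  have h1 := (mem_squareSet.1 (edgeSeg_subset_squareSet hez hpe)).1.2
  have h2 : z.1 + 1 ≤ N := lt_of_abs_lt (hS z hz).1
  have h3 : (z.1 : ℝ) + 1 ≤ N := by exact_mod_cast h2
  show p.1 ≤ (N : ℝ) - 1 / 2
  linarith

theorem IsOuter.inExterior (hS : InBox S N) {E : Set (Sym2 GridV)}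
    (hE : E ⊆ ⋃ z ∈ S, squareEdges z) {w : GridV} (hw : IsOuter S N w) :
    inExterior E (squareSet w) := by
  induction hw with
  | base h => exact inExterior_of_isRight hS hE h
  | @step w w' hadj hw h ih =>
    obtain ⟨e, he, he'⟩ := hadj.exists_mem_squareEdges
    refine inExterior_squareSet_of_shared_edge (isGridGraph_of_subset hE) he' he (fun heE => ?_) ih
    obtain ⟨a, ha, hea⟩ := Set.mem_iUnion₂.1 (hE heE)
    rcases eq_or_eq_of_mem_squareEdges hadj.ne he he' hea with rfl | rfl
    exacts [hw ha, h.notMem hS ha]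

theorem inExterior_of_notMem_cell (hS : InBox S N) {z : GridV} (hz : ¬ IsOuter S N z)
    {w : GridV} (hw : w ∉ cell S N z) :
    inExterior (boundaryEdges (cell S N z)) (squareSet w) := by
  have hE := (boundaryEdges_cell_subset hz).trans outerEdges_subset
  have main : ∀ (n : ℕ) (w : GridV), N - w.1 ≤ n → w ∉ cell S N z →
      inExterior (boundaryEdges (cell S N z)) (squareSet w) := by
    intro n
    induction n with
    | zero => exact fun w hn _ => inExterior_of_isRight hS hE (by simpa using hn)
    | succ n ih =>
      intro w hn hw
      by_cases hwo : IsOuter S N w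
      · exact hwo.inExterior hS hE
      have hadj : plusAdj w (w + (1, 0)) := by simp [plusAdj]
      have hw' : w + (1, 0) ∉ cell S N z := fun h =>
        hw (mem_cell_of_plusAdj hz h hadj.symm hwo)
      obtain ⟨e, he, he'⟩ := hadj.exists_mem_squareEdges
      refine inExterior_squareSet_of_shared_edge (isGridGraph_of_subset hE) he' he ?_
        (ih _ (by simp only [Prod.fst_add]; push_cast at hn; omega) hw')
      rintro ⟨a, ha, -, -, hea, -⟩
      rcases eq_or_eq_of_mem_squareEdges hadj.ne he he' hea with rfl | rfl
      exacts [hw ha, hw' ha]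
  exact main (N - w.1).toNat w (Int.self_le_toNat _) hw

theorem exists_mem_cell_of_mem_interiorOf (hS : InBox S N) {z : GridV} (hz : ¬ IsOuter S N z)
    {p : ℝ × ℝ} (hp : p ∈ interiorOf (boundaryEdges (cell S N z))) :
    ∃ w ∈ cell S N z, p ∈ squareSet w := by
  obtain ⟨w, hw⟩ := exists_mem_squareSet p
  refine ⟨w, by_contra fun h => ?_, hw⟩
  exact (inExterior_iff.1 (inExterior_of_notMem_cell hS hz h) ⟨hw, hp.1⟩).2 hp.2

theorem disjoint_interiorOf (hS : InBox S N) {z z' : GridV} (hz : ¬ IsOuter S N z)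
    (hz' : ¬ IsOuter S N z') (hne : cell S N z ≠ cell S N z') :
    Disjoint (interiorOf (boundaryEdges (cell S N z)))
      (interiorOf (boundaryEdges (cell S N z'))) := by
  rw [Set.disjoint_left]
  intro p hp hp'
  obtain ⟨w, hw, hpw⟩ := exists_mem_cell_of_mem_interiorOf hS hz hp
  obtain ⟨w', hw', hpw'⟩ := exists_mem_cell_of_mem_interiorOf hS hz' hp'
  refine hp.1 (mem_carrierOf_boundaryEdges hw (fun h => hne ?_) hpw hpw')
  rw [← cell_eq_of_mem h, ← cell_eq_of_mem hw']

/-- A closed chain supported on the outer edges is constant on the boundary of each cell. -/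
theorem exists_eq_on_boundaryEdges_cell (hS : InBox S N) {c : Sym2 GridV → ZMod 2}
    (hsupp : ∀ e, c e ≠ 0 → e ∈ outerEdges S N) (hc : ∀ v, chainBoundary c v = 0) {z : GridV}
    (hz : ¬ IsOuter S N z) : ∃ t, ∀ e ∈ boundaryEdges (cell S N z), c e = t := by
  have hlt : ∀ a ∈ S, a.1 < N := fun a ha => lt_of_abs_lt (hS a ha).1
  obtain ⟨f, hf0, hf⟩ := exists_potential (c := c) (N := N)
    (fun z hz => by
      by_contra h
      obtain ⟨a, ha, -, -, hea, -⟩ := hsupp _ h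
      have := hlt a ha
      rcases hEdge_mem_squareEdges.1 hea with rfl | rfl
      · omega
      · simp only [Prod.fst_sub] at this; omega)
    (fun z hz => by
      by_contra h
      obtain ⟨a, ha, -, -, hea, -⟩ := hsupp _ h
      have := hlt a ha
      rcases vEdge_mem_squareEdges.1 hea with rfl | rfl
      · omega
      · simp only [Prod.fst_sub] at this; omega) hc
  have hfadj : ∀ a b, plusAdj a b → (IsOuter S N a ↔ IsOuter S N b) → f a = f b := by
    intro a b hab ho
    obtain ⟨e, hea, heb⟩ := hab.exists_mem_squareEdges
    rw [← CharTwo.add_eq_zero, hf a b e hab.ne hea heb]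
    by_contra h
    obtain ⟨a', ha', b', hb', hea', heb'⟩ := hsupp e h
    have hno : ¬ IsOuter S N a' := fun h => h.notMem hS ha'
    rcases eq_or_eq_of_mem_squareEdges hab.ne hea heb hea' with rfl | rfl <;>
      rcases eq_or_eq_of_mem_squareEdges hab.ne hea heb heb' with rfl | rfl <;> tauto
  have hfo : ∀ w, IsOuter S N w → f w = 0 := by
    intro w hw
    induction hw with
    | base h => exact hf0 _ h
    | step hadj hw h ih =>
      rw [hfadj _ _ hadj (iff_of_true (.step hadj hw h) h), ih]
  have hfc : ∀ w ∈ cell S N z, f w = f z := by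
    intro w hw
    induction hw with
    | refl => rfl
    | tail _ h ih => rw [← ih, hfadj _ _ h.1 (iff_of_false h.2.1 h.2.2)]
  refine ⟨f z, fun e he => ?_⟩
  obtain ⟨a, -, ha, b, hb, hea, heb⟩ := exists_of_mem_boundaryEdges_cell hz he
  have hab : a ≠ b := fun h => not_isOuter_of_mem_cell hz ha (h ▸ hb)
  rw [← hf a b e hab hea heb, hfc a ha, hfo b hb, add_zero]

theorem boundaryEdges_cell_nonempty {z : GridV} (hz : ¬ IsOuter S N z) :
    (boundaryEdges (cell S N z)).Nonempty := by
  by_contra hne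
  have hright : ∀ n : ℕ, z + (n • (1, 0) : GridV) ∈ cell S N z := by
    intro n
    induction n with
    | zero => simpa using mem_cell_self z
    | succ n ih =>
      by_contra h
      rw [succ_nsmul, ← add_assoc] at h
      have hadj : plusAdj (z + (n • (1, 0) : GridV)) (z + (n • (1, 0) : GridV) + (1, 0)) := by
        simp [plusAdj]
      obtain ⟨e, he, he'⟩ := hadj.exists_mem_squareEdges
      exact hne ⟨e, _, ih, _, h, he, he'⟩
  refine not_isOuter_of_mem_cell hz (hright (N - z.1).toNat) (.base ?_)
  have := Int.self_le_toNat (N - z.1)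
  rw [Prod.fst_add, Prod.smul_fst, nsmul_eq_mul, mul_one]
  omega

theorem vertexSetOf_boundaryEdges_cell_nonempty {z : GridV}
    (hz : ¬ IsOuter S N z) : (vertexSetOf (boundaryEdges (cell S N z))).Nonempty := by
  obtain ⟨e, he⟩ := boundaryEdges_cell_nonempty hz
  induction e with
  | h x y => exact ⟨x, _, he, Sym2.mem_mk_left _ _⟩

theorem boundaryEdges_cell_subset_of_isCycle (hS : InBox S N) {E : Set (Sym2 GridV)}
    (hE : IsCycle E) (hEo : E ⊆ outerEdges S N) {z : GridV} (hz : ¬ IsOuter S N z)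
    {e : Sym2 GridV} (he : e ∈ E) (hez : e ∈ boundaryEdges (cell S N z)) :
    boundaryEdges (cell S N z) ⊆ E := by
  obtain ⟨C, rfl⟩ := hE
  obtain ⟨c, hsupp, hc⟩ := C.exists_closed_chain
  obtain ⟨t, ht⟩ := exists_eq_on_boundaryEdges_cell hS (fun e he => hEo ((hsupp e).1 he)) hc hz
  intro e' he'
  rw [← hsupp, ht e' he', ← ht e hez]
  exact (hsupp e).2 he

theorem isCycle_boundaryEdges_cell (hS : InBox S N) {z : GridV} (hz : ¬ IsOuter S N z) :
    IsCycle (boundaryEdges (cell S N z)) := by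
  have hfin : (boundaryEdges (cell S N z)).Finite := by
    refine ((finite_cell hS hz).biUnion fun w _ => finite_squareEdges w).subset ?_
    rintro e ⟨a, ha, -, -, hea, -⟩
    exact Set.mem_biUnion ha hea
  obtain ⟨C, hC⟩ := exists_cycle_of_no_dead_end hfin
    (fun u v ⟨_, _, _, _, h, _⟩ => gridAdj_of_mem_squareEdges h)
    (boundaryEdges_cell_nonempty hz) fun u v => exists_boundaryEdges_extend
  exact ⟨C, hC.antisymm (boundaryEdges_cell_subset_of_isCycle hS ⟨C, rfl⟩
    (hC.trans (boundaryEdges_cell_subset hz)) hz (C.edge_mem 0) (hC (C.edge_mem 0)))⟩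

/-- The boundaries of two distinct cells share at most one corner. -/
theorem subsingleton_vertexSetOf_inter (hS : InBox S N) {z z' : GridV} (hz : ¬ IsOuter S N z)
    (hz' : ¬ IsOuter S N z') (hne : cell S N z ≠ cell S N z') :
    (vertexSetOf (boundaryEdges (cell S N z)) ∩
      vertexSetOf (boundaryEdges (cell S N z'))).Subsingleton := by
  classical
  obtain ⟨C, hC⟩ := isCycle_boundaryEdges_cell hS hz
  obtain ⟨D, hD⟩ := isCycle_boundaryEdges_cell hS hz'
  rintro v ⟨hv, hv'⟩ w ⟨hw, hw'⟩
  by_contra hvw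
  rw [← hC] at hv hw
  rw [← hD] at hv' hw'
  obtain ⟨c, hc, hcb, ⟨e₁, he₁, hce₁⟩, e₀, he₀, hce₀⟩ := GridCycle.exists_arc hv hw hvw
  obtain ⟨d, hd, hdb, -⟩ := GridCycle.exists_arc hv' hw' hvw
  rw [hC] at hc he₁ he₀
  rw [hD] at hd
  have hdisj : ∀ e ∈ boundaryEdges (cell S N z), d e = 0 := fun e he =>
    by_contra fun h => hne (cell_eq_of_mem_boundaryEdges hz hz' he (hd e h))
  obtain ⟨t, ht⟩ := exists_eq_on_boundaryEdges_cell (c := c + d) hS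
    (fun e he => by
      by_cases hce : c e = 0
      · exact boundaryEdges_cell_subset hz' (hd e fun h => he (by simp [hce, h]))
      · exact boundaryEdges_cell_subset hz (hc e hce))
    (fun x => by rw [chainBoundary_add, hcb, hdb, CharTwo.add_self_eq_zero]) hz
  have h1 := ht e₁ he₁
  have h0 := ht e₀ he₀
  rw [Pi.add_apply, hce₁, hdisj _ he₁, add_zero] at h1
  rw [Pi.add_apply, hce₀, hdisj _ he₀, add_zero] at h0
  exact zero_ne_one (h0.trans h1.symm)

theorem outermostBoundaryEdgeIn_iff (hS : InBox S N) {e : Sym2 GridV} :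
    outermostBoundaryEdgeIn (⋃ z ∈ S, squareEdges z) e ↔
      ∃ z ∈ S, e ∈ boundaryEdges (cell S N z) := by
  have hno : ∀ z ∈ S, ¬ IsOuter S N z := fun z hz h => h.notMem hS hz
  constructor
  · rintro ⟨he, h⟩
    obtain ⟨a, ha, hea⟩ := Set.mem_iUnion₂.1 he
    have hsub := (boundaryEdges_cell_subset (hno a ha)).trans outerEdges_subset
    refine ⟨a, ha, ?_⟩
    rcases h _ ⟨isCycle_boundaryEdges_cell hS (hno a ha), hsub⟩ with h | h
    · exact h
    · obtain ⟨m, hm, huniq⟩ := exists_mem_edgeSeg_unique hea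
      by_contra hne
      have hmE : m ∉ carrierOf (boundaryEdges (cell S N a)) := by
        intro hmem
        obtain ⟨e', he', hme'⟩ := mem_carrierOf.1 hmem
        obtain ⟨w', hw'⟩ := isGridGraph_of_subset hsub e' he'
        exact hne (huniq e' w' hw' hme' ▸ he')
      exact (inExterior_iff.1 h ⟨hm, hmE⟩).2 (inInterior_iff.1 (inInterior_squareSet
        (finite_cell hS (hno a ha)) (mem_cell_self a))
        ⟨edgeSeg_subset_squareSet hea hm, hmE⟩).2
  · rintro ⟨z, hz, he⟩
    obtain ⟨a, ha, -, b, hb, hea, heb⟩ := exists_of_mem_boundaryEdges_cell (hno z hz) he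
    refine ⟨Set.mem_biUnion ha hea, fun E hE => .inr ?_⟩
    exact (edgeSeg_subset_squareSet heb).trans (hb.inExterior hS hE.2)

end

theorem EdgeSetConnected.of_reflTransGen {E : Set (Sym2 GridV)}
    (h : ∀ u ∈ vertexSetOf E, ∀ v ∈ vertexSetOf E,
      Relation.ReflTransGen (fun a b => s(a, b) ∈ E) u v) : EdgeSetConnected E := by
  intro u v hu hv
  obtain ⟨l, hl, hlast⟩ := List.exists_isChain_cons_of_relationReflTransGen (h u hu v hv)
  exact ⟨u :: l, rfl, by rw [List.getLast?_eq_getLast_of_ne_nil (List.cons_ne_nil _ _), hlast], hl⟩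

theorem IsCycle.reflTransGen {E D : Set (Sym2 GridV)} (hE : IsCycle E) (hD : E ⊆ D)
    {u v : GridV} (hu : u ∈ vertexSetOf E) (hv : v ∈ vertexSetOf E) :
    Relation.ReflTransGen (fun a b => s(a, b) ∈ D) u v := by
  obtain ⟨C, rfl⟩ := hE
  obtain ⟨a, rfl⟩ := GridCycle.mem_vertexSetOf.1 hu
  obtain ⟨b, rfl⟩ := GridCycle.mem_vertexSetOf.1 hv
  exact C.induction_on (p := fun i => Relation.ReflTransGen _ (C.f a) (C.f i)) (a := a) .refl
    (fun i hi => hi.tail (hD (C.edge_mem i))) b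

/-- The two edges which diagonally adjacent squares share with a common neighbour meet. -/
theorem exists_common_corner {a b : GridV} (h1 : plusAdj a (a.1, b.2))
    (h2 : plusAdj (a.1, b.2) b) :
    ∃ x : GridV, ∃ e e' : Sym2 GridV, x ∈ e ∧ x ∈ e' ∧ e ∈ squareEdges a ∧
      e ∈ squareEdges (a.1, b.2) ∧ e' ∈ squareEdges (a.1, b.2) ∧ e' ∈ squareEdges b := by
  obtain ⟨a1, a2⟩ := a
  obtain ⟨b1, b2⟩ := b
  refine ⟨(max a1 b1, max a2 b2), hEdge (a1, max a2 b2), vEdge (max a1 b1, b2), ?_⟩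
  simp only [plusAdj, sub_self, abs_zero, add_zero, zero_add] at h1 h2
  simp only [hEdge_mem_squareEdges, vEdge_mem_squareEdges]
  simp only [hEdge, vEdge, Sym2.mem_iff, Prod.mk_add_mk, Prod.mk_sub_mk, Prod.mk.injEq]
  grind

theorem starComp_of_starAdj {ω : GridV → Prop} {a b : GridV} (ha : a ∈ starComp ω) (hb : ω b)
    (hab : starAdj a b) : b ∈ starComp ω :=
  ⟨hb, ha.2.tail ⟨ha.1, hb, hab⟩⟩

theorem plusAdj.starAdj {a b : GridV} (h : plusAdj a b) : starAdj a b := by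
  refine ⟨h.ne, ?_⟩
  unfold plusAdj at h
  have := abs_nonneg (a.1 - b.1)
  have := abs_nonneg (a.2 - b.2)
  omega

/-- Star-adjacent squares of `S` have cells whose boundaries share a corner. -/
theorem exists_common_vertex {S : Set GridV} {N : ℤ} (hS : InBox S N) {a b : GridV} (ha : a ∈ S)
    (hb : b ∈ S) (hab : starAdj a b) :
    (vertexSetOf (boundaryEdges (cell S N a)) ∩
      vertexSetOf (boundaryEdges (cell S N b))).Nonempty := by
  have hno : ∀ z ∈ S, ¬ IsOuter S N z := fun z hz h => h.notMem hS hz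
  have hsame : b ∈ cell S N a → (vertexSetOf (boundaryEdges (cell S N a)) ∩
      vertexSetOf (boundaryEdges (cell S N b))).Nonempty := by
    intro h
    rw [cell_eq_of_mem h, Set.inter_self]
    exact vertexSetOf_boundaryEdges_cell_nonempty (hno a ha)
  obtain ⟨hne, h1, h2⟩ := hab
  by_cases hp : plusAdj a b
  · exact hsame (mem_cell_of_plusAdj (hno a ha) (mem_cell_self a) hp (hno b hb))
  have hac : plusAdj a (a.1, b.2) := by
    simp only [plusAdj, Ne, Prod.ext_iff, sub_self, abs_zero] at *
    grind
  have hcb : plusAdj (a.1, b.2) b := by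
    simp only [plusAdj, Ne, Prod.ext_iff, sub_self, abs_zero] at *
    grind
  by_cases hc : IsOuter S N (a.1, b.2)
  · obtain ⟨x, e, e', hxe, hxe', hea, hec, hec', heb⟩ := exists_common_corner hac hcb
    exact ⟨x, ⟨e, mem_boundaryEdges_cell (hno a ha) (mem_cell_self a) hc hea hec, hxe⟩,
      ⟨e', mem_boundaryEdges_cell (hno b hb) (mem_cell_self b) hc heb hec', hxe'⟩⟩
  · exact hsame (mem_cell_of_plusAdj (hno a ha)
      (mem_cell_of_plusAdj (hno a ha) (mem_cell_self a) hac hc) hcb (hno b hb))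

theorem edgeSetConnected_boundaryEdges_cells {ω : GridV → Prop} {N : ℤ}
    (hS : InBox (starComp ω) N) :
    EdgeSetConnected
      (⋃₀ ((fun z => boundaryEdges (cell (starComp ω) N z)) '' starComp ω)) := by
  set S := starComp ω with hSdef
  set D := ⋃₀ ((fun z => boundaryEdges (cell S N z)) '' S) with hD
  have hno : ∀ z ∈ S, ¬ IsOuter S N z := fun z hz h => h.notMem hS hz
  have hsub : ∀ z ∈ S, boundaryEdges (cell S N z) ⊆ D := fun z hz =>
    Set.subset_sUnion_of_mem ⟨z, hz, rfl⟩
  have hcyc : ∀ z ∈ S, ∀ u ∈ vertexSetOf (boundaryEdges (cell S N z)),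
      ∀ v ∈ vertexSetOf (boundaryEdges (cell S N z)),
        Relation.ReflTransGen (fun a b => s(a, b) ∈ D) u v := fun z hz u hu v hv =>
    (isCycle_boundaryEdges_cell hS (hno z hz)).reflTransGen (hsub z hz) hu hv
  have hzero : S.Nonempty → (0, 0) ∈ S := by
    rintro ⟨z, hz, h⟩
    rcases Relation.ReflTransGen.cases_head h with rfl | ⟨_, h, -⟩
    exacts [⟨hz, .refl⟩, ⟨h.1, .refl⟩]
  have hfrom : ∀ z ∈ S, ∀ u ∈ vertexSetOf (boundaryEdges (cell S N (0, 0))),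
      ∀ v ∈ vertexSetOf (boundaryEdges (cell S N z)),
        Relation.ReflTransGen (fun a b => s(a, b) ∈ D) u v := by
    rintro z ⟨hωz, hz⟩
    induction hz with
    | refl => exact hcyc _ ⟨hωz, .refl⟩
    | @tail a b hpath hab ih =>
      intro u hu v hv
      have ha : a ∈ S := ⟨hab.1, hpath⟩
      have hb : b ∈ S := starComp_of_starAdj ha hab.2.1 hab.2.2
      obtain ⟨x, hxa, hxb⟩ := exists_common_vertex hS ha hb hab.2.2
      exact (ih hab.1 u hu x hxa).trans (hcyc b hb x hxb v hv)
  refine .of_reflTransGen ?_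
  rintro u ⟨e, ⟨_, ⟨z, hz, rfl⟩, he⟩, hue⟩ v ⟨e', ⟨_, ⟨z', hz', rfl⟩, he'⟩, hve'⟩
  obtain ⟨x, hx⟩ := vertexSetOf_boundaryEdges_cell_nonempty (hno _ (hzero ⟨z, hz⟩))
  have hux : Relation.ReflTransGen (fun a b => s(a, b) ∈ D) u x :=
    Relation.ReflTransGen.mono (fun a b h => by rwa [Sym2.eq_swap]) _ _
      (Relation.ReflTransGen.swap _ _ (hfrom z hz x hx u ⟨e, he, hue⟩))
  exact hux.trans (hfrom z' hz' x hx v ⟨e', he', hve'⟩)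

/-- If the star-connected occupied component `C(0)` is finite and
nonempty, the outermost boundary `∂₀` of `C(0)` is a unique finite set of cycles
`C₁, …, Cₙ` of `G_C` such that: (i) their union is a connected subgraph of `G_C`;
(ii) distinct cycles have disjoint interiors and share at most one vertex;
(iii) every square of `C(0)` is contained in the interior of some cycle;
(iv) every edge of every cycle is a boundary edge adjacent to an occupied square of
`C(0)` in its interior and to a vacant square in its exterior; and moreover an edge of
`G_C` is an outermost boundary edge iff it is an edge of one of the cycles. -/
theorem star_outermost_boundary_cycles (ω : GridV → Prop)
    (hfin : (starComp ω).Finite) (hne : (starComp ω).Nonempty) :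
    ∃! 𝒞 : Set (Set (Sym2 GridV)),
      𝒞.Finite ∧
      (∀ E ∈ 𝒞, IsCycleIn (gcEdges ω) E) ∧
      EdgeSetConnected (⋃₀ 𝒞) ∧
      (∀ E₁ ∈ 𝒞, ∀ E₂ ∈ 𝒞, E₁ ≠ E₂ →
        Disjoint (interiorOf E₁) (interiorOf E₂) ∧
        (vertexSetOf E₁ ∩ vertexSetOf E₂).Subsingleton) ∧
      (∀ z ∈ starComp ω, ∃ E ∈ 𝒞, inInterior E (squareSet z)) ∧
      (∀ E ∈ 𝒞, ∀ e ∈ E,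
        (∃ w ∈ starComp ω, e ∈ squareEdges w ∧ inInterior E (squareSet w)) ∧
        (∃ w, ¬ ω w ∧ e ∈ squareEdges w ∧ inExterior E (squareSet w))) ∧
      (∀ e, outermostBoundaryEdgeIn (gcEdges ω) e ↔ e ∈ ⋃₀ 𝒞) := by
  obtain ⟨N, hS⟩ := exists_inBox hfin
  have hno : ∀ z ∈ starComp ω, ¬ IsOuter (starComp ω) N z := fun z hz h => h.notMem hS hz
  refine ⟨(fun z => boundaryEdges (cell (starComp ω) N z)) '' starComp ω,
    ⟨hfin.image _, ?_, edgeSetConnected_boundaryEdges_cells hS, ?_, ?_, ?_, ?_⟩, ?_⟩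
  · rintro _ ⟨z, hz, rfl⟩
    exact ⟨isCycle_boundaryEdges_cell hS (hno z hz),
      (boundaryEdges_cell_subset (hno z hz)).trans outerEdges_subset⟩
  · rintro _ ⟨z, hz, rfl⟩ _ ⟨z', hz', rfl⟩ hE
    have hcell : cell (starComp ω) N z ≠ cell (starComp ω) N z' := fun h =>
      hE (congrArg boundaryEdges h)
    exact ⟨disjoint_interiorOf hS (hno z hz) (hno z' hz') hcell,
      subsingleton_vertexSetOf_inter hS (hno z hz) (hno z' hz') hcell⟩
  · exact fun z hz => ⟨_, ⟨z, hz, rfl⟩,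
      inInterior_squareSet (finite_cell hS (hno z hz)) (mem_cell_self z)⟩
  · rintro _ ⟨z, hz, rfl⟩ e he
    obtain ⟨a, ha, haz, b, hb, hea, heb⟩ := exists_of_mem_boundaryEdges_cell (hno z hz) he
    have hab : plusAdj a b :=
      plusAdj_of_mem_squareEdges (fun h => hno a ha (h ▸ hb)) hea heb
    exact ⟨⟨a, ha, hea, inInterior_squareSet (finite_cell hS (hno z hz)) haz⟩,
      b, fun hωb => hb.notMem hS (starComp_of_starAdj ha hωb hab.starAdj), heb,
      hb.inExterior hS ((boundaryEdges_cell_subset (hno z hz)).trans outerEdges_subset)⟩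
  · intro e
    rw [Set.sUnion_image, Set.mem_iUnion₂]
    exact (outermostBoundaryEdgeIn_iff hS).trans (by simp only [exists_prop])
  · rintro 𝒞 ⟨-, hcyc, -, -, -, -, hout⟩
    have hmem : ∀ e, e ∈ ⋃₀ 𝒞 ↔ ∃ z ∈ starComp ω, e ∈ boundaryEdges (cell (starComp ω) N z) :=
      fun e => (hout e).symm.trans (outermostBoundaryEdgeIn_iff hS)
    have heq : ∀ E ∈ 𝒞, ∀ e ∈ E, ∀ z ∈ starComp ω,
        e ∈ boundaryEdges (cell (starComp ω) N z) →
          boundaryEdges (cell (starComp ω) N z) = E := by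
      intro E hE e he z hz hez
      refine (isCycle_boundaryEdges_cell hS (hno z hz)).eq_of_subset (hcyc E hE).1
        (boundaryEdges_cell_subset_of_isCycle hS (hcyc E hE).1 (fun e' he' => ?_) (hno z hz) he hez)
      obtain ⟨z', hz', h⟩ := (hmem e').1 ⟨E, hE, he'⟩
      exact boundaryEdges_cell_subset (hno z' hz') h
    ext E
    constructor
    · intro hE
      obtain ⟨C, rfl⟩ := (hcyc E hE).1
      obtain ⟨z, hz, hez⟩ := (hmem _).1 ⟨_, hE, C.edge_mem 0⟩
      exact ⟨z, hz, heq _ hE _ (C.edge_mem 0) z hz hez⟩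
    · rintro ⟨z, hz, rfl⟩
      obtain ⟨e, he⟩ := boundaryEdges_cell_nonempty (hno z hz)
      obtain ⟨E, hE, heE⟩ := (hmem e).2 ⟨z, hz, he⟩
      show boundaryEdges (cell (starComp ω) N z) ∈ 𝒞
      rwa [heq E hE e heE z hz he]
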